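/- Suppose (A1)-(A3) hold. Then for every Λ ⊂ {1,…,d}, all q, q' ∈ ℝ_+^{Λ,d}, and all sequences x_n, x'_n ∈ ℤ_+^{Λ,d} and ε_n > 0 with ε_n → 0, ε_n x'_n → q' and ε_n x_n → q, one has liminf_{n→∞} ε_n log G_Λ(x'_n, x_n) ≥ − sup_{a∈D} a·(q − q'). -/

import Mathlib

open Filter Topology

attribute [local instance] Classical.propDecidable

noncomputable section

variable {V : Type*} [AddCommGroup V]

/-- `n`-step transition kernel of the random walk with step distribution `μ`,
killed upon leaving the set `A` : `kern μ A n x y = P_x(S n = y, τ_A > n)`,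
where `τ_A` is the first exit time from `A`. -/
def kern (μ : V → ℝ) (A : Set V) : ℕ → V → V → ℝ
  | 0 => fun x y => if x = y ∧ x ∈ A then 1 else 0
  | n + 1 => fun x y => ∑' z : V, (if x ∈ A then μ (z - x) else 0) * kern μ A n z y

/-- Green function of the walk killed outside `A`. -/
def green (μ : V → ℝ) (A : Set V) (x y : V) : ℝ :=
  ∑' n : ℕ, kern μ A n x y

/-- `E_x [ g(S τ) ; S τ ∈ B, τ < ∞ ]`, where `τ` is the first exit time from `A`. -/
def exitExp (μ : V → ℝ) (A B : Set V) (g : V → ℝ) (x : V) : ℝ :=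
  ∑' n : ℕ, ∑' z : V, kern μ A n x z *
    ∑' y : V, (if y ∉ A ∧ y ∈ B then μ (y - z) else 0) * g y

/-- `ℝ≥0∞`-valued version of `exitExp`. -/
def exitExpE (μ : V → ℝ) (A B : Set V) (g : V → ℝ) (x : V) : ENNReal :=
  ∑' n : ℕ, ∑' z : V, ENNReal.ofReal (kern μ A n x z) *
    ∑' y : V, ENNReal.ofReal ((if y ∉ A ∧ y ∈ B then μ (y - z) else 0) * g y)

/-- `P_x(S t = y for some t ≥ 0)` for the walk killed outside `A`
(first passage decomposition). -/
def hitProb (μ : V → ℝ) (A : Set V) (x y : V) : ℝ :=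
  (if x = y ∧ x ∈ A then 1 else 0) +
    ∑' n : ℕ, ∑' z : V, kern μ (A \ {y}) n x z * (if y ∈ A then μ (y - z) else 0)

/-- `h` is (strictly speaking, satisfies the mean value property of a) harmonic
function on `A` for the walk with step distribution `μ` killed outside `A`. -/
def HarmOn (μ : V → ℝ) (A : Set V) (h : V → ℝ) : Prop :=
  ∀ x ∈ A, h x = ∑' y : V, if y ∈ A then μ (y - x) * h y else 0

/-- Irreducibility of the walk killed outside `A`. -/
def Irred (μ : V → ℝ) (A : Set V) : Prop :=
  ∀ x ∈ A, ∀ x' ∈ A, ∃ (k : ℕ) (c : ℕ → V), c 0 = x ∧ c k = x' ∧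
    (∀ j ≤ k, c j ∈ A) ∧ ∀ j < k, 0 < μ (c (j + 1) - c j)

/-- A sequence `xs` is fundamental for the walk killed outside `A` :
the Martin kernels `G(x, xs n)/G(x₀, xs n)` converge for every `x ∈ A`. -/
def Fundamental (μ : V → ℝ) (A : Set V) (x₀ : V) (xs : ℕ → V) : Prop :=
  ∀ x ∈ A, ∃ L : ℝ,
    Tendsto (fun n => green μ A x (xs n) / green μ A x₀ (xs n)) atTop (𝓝 L)

/-- ℓ¹-norm of an integer vector. -/
def znorm {ι : Type*} [Fintype ι] (x : ι → ℤ) : ℝ := ∑ i, |(x i : ℝ)|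

/-- ℓ¹-norm of a real vector. -/
def rnorm {ι : Type*} [Fintype ι] (q : ι → ℝ) : ℝ := ∑ i, |q i|

variable {d : ℕ}

/-- `ℤ^{Λ,d}_+ = {x ∈ ℤ^d : xⁱ > 0 for all i ∈ Λ}`. -/
def posDom (Λ : Set (Fin d)) : Set (Fin d → ℤ) := {x | ∀ i ∈ Λ, 0 < x i}

/-- `ℤ^d_+ = {x ∈ ℤ^d : xⁱ > 0 for all i}`. -/
def posAll : Set (Fin d → ℤ) := {x | ∀ i, 0 < x i}

/-- `a · z` for `a ∈ ℝ^d`, `z ∈ ℤ^d`. -/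
def dotZ (a : Fin d → ℝ) (z : Fin d → ℤ) : ℝ := ∑ i, a i * (z i : ℝ)

/-- `a · q` for `a, q ∈ ℝ^d`. -/
def dotR (a q : Fin d → ℝ) : ℝ := ∑ i, a i * q i

/-- jump generating function `φ(a) = Σ_z μ(z) exp(a·z)` (valued in `ℝ≥0∞`). -/
def phiE (μ : (Fin d → ℤ) → ℝ) (a : Fin d → ℝ) : ENNReal :=
  ∑' z : Fin d → ℤ, ENNReal.ofReal (μ z * Real.exp (dotZ a z))

/-- `D = {a ∈ ℝ^d : φ(a) ≤ 1}`. -/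
def Dset (μ : (Fin d → ℤ) → ℝ) : Set (Fin d → ℝ) := {a | phiE μ a ≤ 1}

/-- mean vector `M = Σ_z μ(z) z`. -/
def Mvec (μ : (Fin d → ℤ) → ℝ) : Fin d → ℝ := fun i => ∑' z : Fin d → ℤ, μ z * (z i : ℝ)

/-- `Λ(M) = {i : Mⁱ = 0}`. -/
def LambdaM (μ : (Fin d → ℤ) → ℝ) : Set (Fin d) := {i | Mvec μ i = 0}

/-- Assumption (A1) : irreducibility on every `ℤ^{Λ,d}_+`. -/
def A1 (μ : (Fin d → ℤ) → ℝ) : Prop := ∀ Λ : Set (Fin d), Irred μ (posDom Λ)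

/-- Assumption (A2) : `φ` is finite on a neighborhood of the set `D`. -/
def A2 (μ : (Fin d → ℤ) → ℝ) : Prop :=
  ∃ U : Set (Fin d → ℝ), IsOpen U ∧ Dset μ ⊆ U ∧ ∀ a ∈ U, phiE μ a ≠ ⊤

/-- Assumption (A3) : `M ≠ 0`. -/
def A3 (μ : (Fin d → ℤ) → ℝ) : Prop := Mvec μ ≠ 0

/-- projection `x ↦ x^Λ`. -/
def projL (Λ : Set (Fin d)) (x : Fin d → ℤ) : ↥Λ → ℤ := fun i => x (i : Fin d)

/-- jump distribution `μ_Λ(v) = Σ_{x : x^Λ = v} μ(x)` of the projected walk. -/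
def muL (μ : (Fin d → ℤ) → ℝ) (Λ : Set (Fin d)) (v : ↥Λ → ℤ) : ℝ :=
  ∑' x : Fin d → ℤ, if projL Λ x = v then μ x else 0

/-- `ℤ^Λ_+`. -/
def posL (Λ : Set (Fin d)) : Set (↥Λ → ℤ) := {u | ∀ i, 0 < u i}

end

section RationalCone

variable {E : Type*} [AddCommGroup E] [Module ℝ E] [TopologicalSpace E]
  [IsTopologicalAddGroup E] [ContinuousSMul ℝ E]

theorem AddSubmonoid.smul_mem_topologicalClosure (Q : AddSubmonoid E)
    (hQ : ∀ n : ℕ, ∀ x ∈ Q, ((n : ℝ)⁻¹) • x ∈ Q) {t : ℝ} (ht : 0 ≤ t) {x : E}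
    (hx : x ∈ Q.topologicalClosure) : t • x ∈ Q.topologicalClosure := by
  have key : ∀ y ∈ Q, t • y ∈ Q.topologicalClosure := by
    intro y hy
    have hlim : Tendsto (fun n : ℕ => ((⌊t * n⌋₊ : ℝ) / n) • y) atTop (𝓝 (t • y)) :=
      ((tendsto_nat_floor_mul_div_atTop ht).comp tendsto_natCast_atTop_atTop).smul_const y
    refine mem_closure_of_tendsto hlim (Eventually.of_forall fun n => ?_)
    have h := hQ n _ (Q.nsmul_mem hy ⌊t * n⌋₊)
    rwa [← Nat.cast_smul_eq_nsmul ℝ, smul_smul, inv_mul_eq_div] at h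
  have h := map_mem_closure (continuous_const_smul t) hx key
  rwa [Q.isClosed_topologicalClosure.closure_eq] at h

/-- Farkas' lemma for an additive submonoid stable under division by natural numbers. -/
theorem AddSubmonoid.exists_dual_neg_of_notMem_closure [LocallyConvexSpace ℝ E]
    (Q : AddSubmonoid E) (hQ : ∀ n : ℕ, ∀ x ∈ Q, ((n : ℝ)⁻¹) • x ∈ Q)
    {x₀ : E} (hx₀ : x₀ ∉ _root_.closure (Q : Set E)) :
    ∃ f : E →L[ℝ] ℝ, (∀ x ∈ Q, 0 ≤ f x) ∧ f x₀ < 0 := by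
  let C : ProperCone ℝ E :=
    { toSubmodule :=
        { Q.topologicalClosure with
          smul_mem' := fun c x hx => Q.smul_mem_topologicalClosure hQ c.2 hx }
      isClosed' := Q.isClosed_topologicalClosure }
  have hC : ∀ x, x ∈ C ↔ x ∈ _root_.closure (Q : Set E) := fun x => by rfl
  obtain ⟨f, hf, hf₀⟩ := C.hyperplane_separation_point (mt (hC x₀).1 hx₀)
  exact ⟨f, fun x hx => hf x ((hC x).2 (_root_.subset_closure hx)), hf₀⟩

end RationalCone

section KilledWalk

variable {V : Type*} [AddCommGroup V] {μ : V → ℝ} {A B : Set V}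

theorem kern_succ_eq (n : ℕ) {x : V} (hx : x ∈ A) (y : V) :
    kern μ A (n + 1) x y = ∑' w : V, μ w * kern μ A n (x + w) y := by
  rw [← (Equiv.addLeft (-x)).tsum_eq]
  simp [kern, hx, sub_eq_neg_add]

theorem kern_of_notMem (n : ℕ) {x : V} (hx : x ∉ A) (y : V) : kern μ A n x y = 0 := by
  cases n <;> simp [kern, hx]

theorem kern_nonneg (hnn : ∀ z, 0 ≤ μ z) (n : ℕ) (x y : V) : 0 ≤ kern μ A n x y := by
  induction n generalizing x with
  | zero => simp only [kern]; split_ifs <;> norm_num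
  | succ n ih =>
    by_cases hx : x ∈ A
    · rw [kern_succ_eq n hx]
      exact tsum_nonneg fun w => mul_nonneg (hnn w) (ih _)
    · rw [kern_of_notMem _ hx]

theorem kern_le_one (hnn : ∀ z, 0 ≤ μ z) (hsum : HasSum μ 1) (n : ℕ) (x y : V) :
    kern μ A n x y ≤ 1 := by
  induction n generalizing x with
  | zero => simp only [kern]; split_ifs <;> norm_num
  | succ n ih =>
    by_cases hx : x ∈ A
    · rw [kern_succ_eq n hx, ← hsum.tsum_eq]
      have hle : ∀ w, μ w * kern μ A n (x + w) y ≤ μ w :=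
        fun w => mul_le_of_le_one_right (hnn w) (ih _)
      exact (Summable.of_nonneg_of_le (fun w => mul_nonneg (hnn w) (kern_nonneg hnn _ _ _))
        hle hsum.summable).tsum_le_tsum hle hsum.summable
    · rw [kern_of_notMem _ hx]; norm_num

theorem summable_mul_kern (hnn : ∀ z, 0 ≤ μ z) (hsum : HasSum μ 1) (n : ℕ) (x y : V) :
    Summable fun w => μ w * kern μ A n (x + w) y :=
  Summable.of_nonneg_of_le (fun w => mul_nonneg (hnn w) (kern_nonneg hnn _ _ _))
    (fun w => mul_le_of_le_one_right (hnn w) (kern_le_one hnn hsum _ _ _)) hsum.summable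

theorem sum_mul_kern_le_kern_succ (hnn : ∀ z, 0 ≤ μ z) (hsum : HasSum μ 1) (n : ℕ)
    (F : Finset V) {x : V} (hx : x ∈ A) (y : V) :
    ∑ w ∈ F, μ w * kern μ A n (x + w) y ≤ kern μ A (n + 1) x y := by
  rw [kern_succ_eq n hx]
  exact (summable_mul_kern hnn hsum n x y).sum_le_tsum F
    fun w _ => mul_nonneg (hnn w) (kern_nonneg hnn _ _ _)

theorem kern_mul_kern_le (hnn : ∀ z, 0 ≤ μ z) (hsum : HasSum μ 1) (m n : ℕ) (x y z : V) :
    kern μ A m x y * kern μ A n y z ≤ kern μ A (m + n) x z := by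
  induction m generalizing x with
  | zero =>
    simp only [kern, zero_add]
    split_ifs with h
    · rw [h.1, one_mul]
    · rw [zero_mul]; exact kern_nonneg hnn _ _ _
  | succ m ih =>
    by_cases hx : x ∈ A
    · rw [Nat.add_right_comm, kern_succ_eq m hx, kern_succ_eq (m + n) hx, ← tsum_mul_right]
      refine ((summable_mul_kern hnn hsum m x y).mul_right _).tsum_le_tsum (fun w => ?_)
        (summable_mul_kern hnn hsum _ x z)
      rw [mul_assoc]
      exact mul_le_mul_of_nonneg_left (ih _) (hnn w)
    · simp [kern_of_notMem _ hx]

theorem kern_le_kern_add (hnn : ∀ z, 0 ≤ μ z) (hsum : HasSum μ 1) {w : V}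
    (hAB : ∀ u ∈ A, u + w ∈ B) (n : ℕ) (x y : V) :
    kern μ A n x y ≤ kern μ B n (x + w) (y + w) := by
  induction n generalizing x with
  | zero =>
    by_cases hx : x = y ∧ x ∈ A
    · obtain ⟨rfl, hxA⟩ := hx
      simp [kern, hxA, hAB x hxA]
    · exact (if_neg hx).trans_le (kern_nonneg hnn _ _ _)
  | succ n ih =>
    by_cases hx : x ∈ A
    · rw [kern_succ_eq n hx, kern_succ_eq n (hAB x hx)]
      refine (summable_mul_kern hnn hsum n x y).tsum_le_tsum (fun u => ?_)
        (summable_mul_kern hnn hsum n _ _)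
      rw [add_right_comm]
      exact mul_le_mul_of_nonneg_left (ih _) (hnn u)
    · rw [kern_of_notMem _ hx]; exact kern_nonneg hnn _ _ _

/-- The walk killed outside `A` moves from `x` to `y` at an exponential cost of at most `p`. -/
def Reach (μ : V → ℝ) (A : Set V) (x y : V) (p : ℝ) : Prop :=
  ∃ n, Real.exp (-p) ≤ kern μ A n x y

namespace Reach

variable {x y z w : V} {p r : ℝ}

theorem refl (hx : x ∈ A) : Reach μ A x x 0 := ⟨0, by simp [kern, hx]⟩

theorem mono_cost (h : Reach μ A x y p) (hpr : p ≤ r) : Reach μ A x y r :=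
  let ⟨n, hn⟩ := h
  ⟨n, (Real.exp_le_exp.2 (neg_le_neg hpr)).trans hn⟩

theorem trans (hnn : ∀ z, 0 ≤ μ z) (hsum : HasSum μ 1) (h₁ : Reach μ A x y p)
    (h₂ : Reach μ A y z r) : Reach μ A x z (p + r) := by
  obtain ⟨m, hm⟩ := h₁
  obtain ⟨n, hn⟩ := h₂
  refine ⟨m + n, le_trans ?_ (kern_mul_kern_le hnn hsum m n x y z)⟩
  rw [neg_add, Real.exp_add]
  exact mul_le_mul hm hn (Real.exp_pos _).le (kern_nonneg hnn _ _ _)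

theorem shift (hnn : ∀ z, 0 ≤ μ z) (hsum : HasSum μ 1) (h : Reach μ A x y p)
    (hAB : ∀ u ∈ A, u + w ∈ B) : Reach μ B (x + w) (y + w) p :=
  let ⟨n, hn⟩ := h
  ⟨n, hn.trans (kern_le_kern_add hnn hsum hAB n x y)⟩

theorem mono_set (hnn : ∀ z, 0 ≤ μ z) (hsum : HasSum μ 1) (h : Reach μ A x y p)
    (hAB : A ⊆ B) : Reach μ B x y p := by
  simpa using h.shift hnn hsum (w := 0) (B := B) (fun u hu => by simpa using hAB hu)

theorem step (hnn : ∀ z, 0 ≤ μ z) (hsum : HasSum μ 1) (hx : x ∈ A) (hxw : x + w ∈ A)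
    (hw : 0 < μ w) : Reach μ A x (x + w) (-Real.log (μ w)) := by
  refine ⟨1, ?_⟩
  have h := sum_mul_kern_le_kern_succ hnn hsum 0 {w} hx (x + w)
  simpa [kern, hxw, Real.exp_log hw] using h

theorem nsmul (hnn : ∀ z, 0 ≤ μ z) (hsum : HasSum μ 1) (h : Reach μ A 0 z p) (m : ℕ)
    (hx : x ∈ B) (hAB : ∀ j < m, ∀ u ∈ A, u + (x + j • z) ∈ B) :
    Reach μ B x (x + m • z) (m * p) := by
  induction m with
  | zero => simpa using refl hx
  | succ m ih =>
    have h₁ := ih fun j hj => hAB j (hj.trans m.lt_succ_self)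
    have h₂ := h.shift hnn hsum (hAB m m.lt_succ_self)
    rw [zero_add] at h₂
    have h₃ := h₁.trans hnn hsum h₂
    convert h₃ using 1
    · rw [succ_nsmul]; abel
    · push_cast; ring

theorem exp_neg_le_green (hnn : ∀ z, 0 ≤ μ z) (h : Reach μ A x y p)
    (hs : Summable fun n => kern μ A n x y) : Real.exp (-p) ≤ green μ A x y :=
  let ⟨n, hn⟩ := h
  hn.trans (hs.le_tsum n fun _ _ => kern_nonneg hnn _ _ _)

theorem cost_nonneg (hnn : ∀ z, 0 ≤ μ z) (hsum : HasSum μ 1) (h : Reach μ A x y p) : 0 ≤ p := by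
  obtain ⟨n, hn⟩ := h
  simpa using hn.trans (kern_le_one hnn hsum n x y)

theorem neg_le_log_green (hnn : ∀ z, 0 ≤ μ z) (hsum : HasSum μ 1) (h : Reach μ A x y p) :
    -p ≤ Real.log (green μ A x y) := by
  by_cases hs : Summable fun n => kern μ A n x y
  · have h₁ := h.exp_neg_le_green hnn hs
    rwa [Real.le_log_iff_exp_le ((Real.exp_pos _).trans_le h₁)]
  · rw [green, tsum_eq_zero_of_not_summable hs, Real.log_zero]
    exact neg_nonpos.2 (h.cost_nonneg hnn hsum)

/-- A path of positive probability has a finite cost, which dominates the increment of any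
linear functional whose exponential tilt of each step weight is at most one. -/
theorem exists_of_path (hnn : ∀ z, 0 ≤ μ z) (hsum : HasSum μ 1) (c : ℕ → V) (k : ℕ)
    (hc : ∀ j < k, 0 < μ (c (j + 1) - c j)) :
    ∃ p, (∀ A : Set V, (∀ j ≤ k, c j ∈ A) → Reach μ A (c 0) (c k) p) ∧
      ∀ f : V →+ ℝ, (∀ z, μ z * Real.exp (f z) ≤ 1) → f (c k - c 0) ≤ p := by
  induction k with
  | zero => exact ⟨0, fun A hA => refl (hA 0 le_rfl), fun f _ => by simp⟩
  | succ k ih =>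
    obtain ⟨p, hp, hpf⟩ := ih fun j hj => hc j (hj.trans k.lt_succ_self)
    have hk := hc k k.lt_succ_self
    refine ⟨p + -Real.log (μ (c (k + 1) - c k)), fun A hA => ?_, fun f hf => ?_⟩
    · refine (hp A fun j hj => hA j (hj.trans k.le_succ)).trans hnn hsum ?_
      have h := step hnn hsum (w := c (k + 1) - c k) (hA k k.le_succ)
        (by simpa using hA (k + 1) le_rfl) hk
      simpa using h
    · have h₁ := hpf f hf
      have h₂ := Real.log_le_log (by positivity) (hf (c (k + 1) - c k))
      rw [Real.log_mul hk.ne' (Real.exp_ne_zero _), Real.log_exp, Real.log_one] at h₂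
      rw [← sub_add_sub_cancel (c (k + 1)) (c k) (c 0), map_add]
      linarith

end Reach

end KilledWalk

section LatticeWalk

variable {d : ℕ} {μ : (Fin d → ℤ) → ℝ}

/-- The cube of radius `R` around the origin. -/
def latticeBox (R : ℤ) : Set (Fin d → ℤ) := {u | ∀ i, |u i| ≤ R}

/-- Displacements achieved at an exponential cost of at most `p` within a bounded region. -/
def Achieves (μ : (Fin d → ℤ) → ℝ) (z : Fin d → ℤ) (p : ℝ) : Prop :=
  ∃ R, Reach μ (latticeBox R) 0 z p

theorem abs_apply_le_sum_abs (z : Fin d → ℤ) (i : Fin d) : |z i| ≤ ∑ j, |z j| :=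
  Finset.single_le_sum (f := fun j => |z j|) (fun j _ => abs_nonneg (z j)) (Finset.mem_univ i)

namespace Achieves

variable {z w : Fin d → ℤ} {p r : ℝ}

theorem zero : Achieves μ 0 0 := ⟨0, Reach.refl fun i => by simp⟩

theorem mono (h : Achieves μ z p) (hpr : p ≤ r) : Achieves μ z r :=
  let ⟨R, hR⟩ := h
  ⟨R, hR.mono_cost hpr⟩

theorem add (hnn : ∀ z, 0 ≤ μ z) (hsum : HasSum μ 1) (h₁ : Achieves μ z p)
    (h₂ : Achieves μ w r) : Achieves μ (z + w) (p + r) := by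
  obtain ⟨R, hR⟩ := h₁
  obtain ⟨S, hS⟩ := h₂
  have h0 : 0 ≤ ∑ j, |z j| := Finset.sum_nonneg fun j _ => abs_nonneg (z j)
  refine ⟨|R| + |S| + ∑ j, |z j|, ?_⟩
  have h := hS.shift hnn hsum (w := z) (B := latticeBox (|R| + |S| + ∑ j, |z j|))
    fun u hu i => ?_
  · rw [zero_add, add_comm w] at h
    refine (hR.mono_set hnn hsum (B := latticeBox (|R| + |S| + ∑ j, |z j|))
      fun u hu i => ?_).trans hnn hsum h
    linarith [hu i, le_abs_self R, abs_nonneg S]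
  · have h₁ := abs_add_le (u i) (z i)
    have h₂ := abs_apply_le_sum_abs z i
    have h₃ := hu i
    rw [Pi.add_apply]
    linarith [le_abs_self S, abs_nonneg R]

theorem nsmul (hnn : ∀ z, 0 ≤ μ z) (hsum : HasSum μ 1) (h : Achieves μ z p) (m : ℕ) :
    Achieves μ (m • z) (m * p) := by
  induction m with
  | zero => simpa using zero
  | succ m ih =>
    rw [succ_nsmul, Nat.cast_succ, add_mul, one_mul]
    exact ih.add hnn hsum h

end Achieves

/-- Rational multiples of achievable pairs of a displacement and a cost. -/
def achievableCone (hnn : ∀ z, 0 ≤ μ z) (hsum : HasSum μ 1) :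
    AddSubmonoid ((Fin d → ℝ) × ℝ) where
  carrier := {w | ∃ N : ℕ, 0 < N ∧ ∃ z : Fin d → ℤ,
    (∀ i, (N : ℝ) * w.1 i = z i) ∧ Achieves μ z (N * w.2)}
  zero_mem' := ⟨1, one_pos, 0, by simp, by simp [Achieves.zero]⟩
  add_mem' := by
    rintro v w ⟨N, hN, z, hz, hp⟩ ⟨M, hM, y, hy, hr⟩
    refine ⟨N * M, by positivity, M • z + N • y, fun i => ?_, ?_⟩
    · simp [← hz i, ← hy i]; ring
    · convert (hp.nsmul hnn hsum M).add hnn hsum (hr.nsmul hnn hsum N) using 1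
      simp; ring

theorem inv_natCast_smul_mem_achievableCone (hnn : ∀ z, 0 ≤ μ z) (hsum : HasSum μ 1)
    (n : ℕ) (w : (Fin d → ℝ) × ℝ) (hw : w ∈ achievableCone hnn hsum) :
    ((n : ℝ)⁻¹) • w ∈ achievableCone hnn hsum := by
  rcases Nat.eq_zero_or_pos n with rfl | hn
  · simp
  · obtain ⟨N, hN, z, hz, hp⟩ := hw
    have hn' : (n : ℝ) ≠ 0 := by positivity
    refine ⟨N * n, by positivity, z, fun i => ?_, ?_⟩
    · rw [← hz i]; simp; field_simp
    · convert hp using 1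
      simp; field_simp

theorem Achieves.mem_achievableCone (hnn : ∀ z, 0 ≤ μ z) (hsum : HasSum μ 1) {z : Fin d → ℤ}
    {p : ℝ} (h : Achieves μ z p) : ((fun i => (z i : ℝ)), p) ∈ achievableCone hnn hsum :=
  ⟨1, one_pos, z, by simp, by simpa using h⟩

theorem dotZ_add (a : Fin d → ℝ) (z w : Fin d → ℤ) : dotZ a (z + w) = dotZ a z + dotZ a w := by
  simp [dotZ, mul_add, Finset.sum_add_distrib]

/-- `z ↦ a · z` as an additive homomorphism. -/
def dotZHom (a : Fin d → ℝ) : (Fin d → ℤ) →+ ℝ := AddMonoidHom.mk' (dotZ a) (dotZ_add a)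

theorem mul_exp_dotZ_le_one {a : Fin d → ℝ} (ha : a ∈ Dset μ) (z : Fin d → ℤ) :
    μ z * Real.exp (dotZ a z) ≤ 1 := by
  have h := (ENNReal.le_tsum z).trans (show phiE μ a ≤ 1 from ha)
  simpa [ENNReal.ofReal_le_one] using h

theorem exists_achieves (hnn : ∀ z, 0 ≤ μ z) (hsum : HasSum μ 1) (hA1 : A1 μ)
    (z : Fin d → ℤ) : ∃ p, Achieves μ z p ∧ ∀ a ∈ Dset μ, dotZ a z ≤ p := by
  obtain ⟨k, c, h0, hk, -, hc⟩ := hA1 ∅ 0 (by simp [posDom]) z (by simp [posDom])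
  obtain ⟨p, hp, hpf⟩ := Reach.exists_of_path hnn hsum c k hc
  refine ⟨p, ⟨∑ j ∈ Finset.range (k + 1), ∑ i, |c j i|, ?_⟩, fun a ha => ?_⟩
  · rw [← h0, ← hk]
    refine hp _ fun j hj i => (abs_apply_le_sum_abs (c j) i).trans ?_
    exact Finset.single_le_sum (f := fun j => ∑ i, |c j i|)
      (fun j _ => Finset.sum_nonneg fun i _ => abs_nonneg (c j i))
      (Finset.mem_range.2 (Nat.lt_succ_of_le hj))
  · have h := hpf (dotZHom a) (mul_exp_dotZ_le_one ha)
    rwa [h0, hk, sub_zero] at h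

theorem dotZ_single (a : Fin d → ℝ) (i : Fin d) (t : ℤ) :
    dotZ a (Pi.single i t) = a i * t := by
  simp [dotZ, Pi.single_apply]

theorem bddAbove_dotR_Dset (hnn : ∀ z, 0 ≤ μ z) (hsum : HasSum μ 1) (hA1 : A1 μ)
    (v : Fin d → ℝ) : BddAbove ((fun a => dotR a v) '' Dset μ) := by
  choose p _ hp using fun i => exists_achieves hnn hsum hA1 (Pi.single i 1)
  choose r _ hr using fun i => exists_achieves hnn hsum hA1 (Pi.single i (-1))
  refine ⟨∑ i, (|p i| + |r i|) * |v i|, ?_⟩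
  rintro _ ⟨a, ha, rfl⟩
  refine Finset.sum_le_sum fun i _ => (le_abs_self _).trans ?_
  rw [abs_mul]
  have h₁ := hp i a ha
  have h₂ := hr i a ha
  rw [dotZ_single] at h₁ h₂
  push_cast at h₁ h₂
  refine mul_le_mul_of_nonneg_right (abs_le.2 ⟨?_, ?_⟩) (abs_nonneg _) <;>
    linarith [le_abs_self (p i), le_abs_self (r i), abs_nonneg (p i), abs_nonneg (r i)]

theorem pow_mul_exp_le_sum_kern (hnn : ∀ z, 0 ≤ μ z) (hsum : HasSum μ 1) (a : Fin d → ℝ)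
    (F : Finset (Fin d → ℤ)) {R : ℤ} (hF : ∀ z ∈ F, ∀ i, |z i| ≤ R) (hR : 0 ≤ R)
    (B : Finset (Fin d → ℤ)) (L : ℤ) (hB : (B : Set (Fin d → ℤ)) = latticeBox L)
    (n : ℕ) (x : Fin d → ℤ) (hx : ∀ i, |x i| + n * R ≤ L) :
    (∑ z ∈ F, μ z * Real.exp (dotZ a z)) ^ n * Real.exp (dotZ a x) ≤
      ∑ y ∈ B, kern μ (latticeBox L) n x y * Real.exp (dotZ a y) := by
  have hxL : x ∈ latticeBox L := fun i => by
    have := mul_nonneg (Int.natCast_nonneg n) hR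
    linarith [hx i]
  induction n generalizing x with
  | zero =>
    have hxB : x ∈ B := by rw [← Finset.mem_coe, hB]; exact hxL
    simp [kern, hxL, hxB]
  | succ n ih =>
    have hstep : ∀ z ∈ F, ∀ i, |(x + z) i| + n * R ≤ L := fun z hz i => by
      have h₁ := hx i
      have h₂ := hF z hz i
      have h₃ := abs_add_le (x i) (z i)
      push_cast at h₁
      rw [Pi.add_apply]
      linarith
    calc (∑ z ∈ F, μ z * Real.exp (dotZ a z)) ^ (n + 1) * Real.exp (dotZ a x)
        = ∑ z ∈ F, μ z * ((∑ z ∈ F, μ z * Real.exp (dotZ a z)) ^ n *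
            Real.exp (dotZ a (x + z))) := by
          rw [pow_succ, mul_assoc, Finset.sum_mul, Finset.mul_sum]
          refine Finset.sum_congr rfl fun z _ => ?_
          rw [dotZ_add, Real.exp_add]; ring
      _ ≤ ∑ z ∈ F, μ z * ∑ y ∈ B, kern μ (latticeBox L) n (x + z) y * Real.exp (dotZ a y) := by
          refine Finset.sum_le_sum fun z hz => mul_le_mul_of_nonneg_left ?_ (hnn z)
          refine ih (x + z) (hstep z hz) fun i => ?_
          have := mul_nonneg (Int.natCast_nonneg n) hR
          linarith [hstep z hz i]
      _ = ∑ y ∈ B, (∑ z ∈ F, μ z * kern μ (latticeBox L) n (x + z) y) *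
            Real.exp (dotZ a y) := by
          simp_rw [Finset.mul_sum, Finset.sum_mul]
          rw [Finset.sum_comm]
          simp_rw [mul_assoc]
      _ ≤ _ := Finset.sum_le_sum fun y _ => mul_le_mul_of_nonneg_right
          (sum_mul_kern_le_kern_succ hnn hsum n F hxL y) (Real.exp_pos _).le

theorem le_one_of_pow_le_poly {ρ b : ℝ} (k : ℕ) (h : ∀ n : ℕ, 0 < n → ρ ^ n ≤ (b * n) ^ k) :
    ρ ≤ 1 := by
  by_contra! hρ
  have hlim := (tendsto_pow_const_div_const_pow_of_one_lt k hρ).const_mul (b ^ k)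
  rw [mul_zero] at hlim
  obtain ⟨n, hn, hn0⟩ := ((hlim.eventually (gt_mem_nhds one_pos)).and
    (eventually_gt_atTop 0)).exists
  have hpos : 0 < ρ ^ n := by positivity
  have := h n hn0
  rw [mul_pow] at this
  rw [← mul_div_assoc, div_lt_one hpos] at hn
  linarith

theorem mem_Dset_of_forall_achieves (hnn : ∀ z, 0 ≤ μ z) (hsum : HasSum μ 1) {a : Fin d → ℝ}
    (ha : ∀ z p, Achieves μ z p → dotZ a z ≤ p) : a ∈ Dset μ := by
  change phiE μ a ≤ 1
  rw [phiE, ENNReal.tsum_eq_iSup_sum]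
  refine iSup_le fun F => ?_
  rw [← ENNReal.ofReal_sum_of_nonneg fun z _ => mul_nonneg (hnn z) (Real.exp_pos _).le,
    ENNReal.ofReal_le_one]
  set R : ℤ := 1 + ∑ z ∈ F, ∑ i, |z i| with hRdef
  have hR : 1 ≤ R := by
    have : 0 ≤ ∑ z ∈ F, ∑ i, |z i| :=
      Finset.sum_nonneg fun z _ => Finset.sum_nonneg fun i _ => abs_nonneg _
    linarith
  have hF : ∀ z ∈ F, ∀ i, |z i| ≤ R := fun z hz i => by
    have h₁ := Finset.single_le_sum (f := fun z : Fin d → ℤ => ∑ i, |z i|)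
      (fun z _ => Finset.sum_nonneg fun i _ => abs_nonneg _) hz
    have h₂ := abs_apply_le_sum_abs z i
    linarith
  refine le_one_of_pow_le_poly (b := 3 * R) d fun n hn => ?_
  set L : ℤ := n * R with hL
  have hn' : (1 : ℤ) ≤ n := by exact_mod_cast hn
  have hL1 : 1 ≤ L := one_le_mul_of_one_le_of_one_le hn' hR
  let B : Finset (Fin d → ℤ) := Fintype.piFinset fun _ => Finset.Icc (-L) L
  have hB : (B : Set (Fin d → ℤ)) = latticeBox L := by
    ext u
    simp only [B, Finset.mem_coe, Fintype.mem_piFinset, Finset.mem_Icc, latticeBox, abs_le]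
    rfl
  have hcard : (B.card : ℝ) = (2 * L + 1) ^ d := by
    have h : (((2 * L + 1).toNat : ℤ) : ℝ) = 2 * L + 1 := by
      rw [Int.toNat_of_nonneg (by linarith)]; push_cast; ring
    simp only [B, Fintype.card_piFinset, Int.card_Icc, Finset.prod_const, Finset.card_univ,
      Fintype.card_fin, Nat.cast_pow]
    rw [show L + 1 - -L = 2 * L + 1 by ring, ← h, Int.cast_natCast]
  have hterm : ∀ y ∈ B, kern μ (latticeBox L) n 0 y * Real.exp (dotZ a y) ≤ 1 := fun y _ => by
    rcases (kern_nonneg hnn n 0 y (A := latticeBox L)).eq_or_lt with h | h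
    · rw [← h, zero_mul]; exact zero_le_one
    · have h₁ := ha y (-Real.log (kern μ (latticeBox L) n 0 y))
        ⟨L, n, by rw [neg_neg, Real.exp_log h]⟩
      rw [← Real.log_nonpos_iff (by positivity), Real.log_mul h.ne' (Real.exp_ne_zero _),
        Real.log_exp]
      linarith
  have hmain := pow_mul_exp_le_sum_kern hnn hsum a F hF (by linarith) B L hB n 0 (by simp [hL])
  rw [show dotZ a (0 : Fin d → ℤ) = 0 from (dotZHom a).map_zero, Real.exp_zero, mul_one] at hmain
  calc _ ≤ _ := hmain
    _ ≤ ∑ _y ∈ B, (1 : ℝ) := Finset.sum_le_sum hterm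
    _ = (2 * L + 1) ^ d := by rw [Finset.sum_const, nsmul_eq_mul, mul_one, hcard]
    _ ≤ (3 * R * n) ^ d := by
        have h₁ : (L : ℝ) = n * R := by rw [hL]; push_cast; ring
        have h₂ : (1 : ℝ) ≤ L := by exact_mod_cast hL1
        refine pow_le_pow_left₀ (by linarith) ?_ d
        linarith

/-- Duality between achievable pairs and the sublevel set of the jump generating function. -/
theorem mem_closure_achievableCone (hnn : ∀ z, 0 ≤ μ z) (hsum : HasSum μ 1) (hA1 : A1 μ)
    {v : Fin d → ℝ} {s : ℝ} (hs : ∀ a ∈ Dset μ, dotR a v ≤ s) :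
    (v, s) ∈ closure (achievableCone hnn hsum : Set ((Fin d → ℝ) × ℝ)) := by
  by_contra hvs
  obtain ⟨f, hf, hf₀⟩ := AddSubmonoid.exists_dual_neg_of_notMem_closure _
    (inv_natCast_smul_mem_achievableCone hnn hsum) hvs
  set a : Fin d → ℝ := fun i => -f (Pi.single i 1, 0) with ha
  set β : ℝ := f (0, 1) with hβ
  have hfeq : ∀ (w : Fin d → ℝ) (r : ℝ), f (w, r) = -dotR a w + β * r := by
    intro w r
    have h₁ : f (w, 0) = -dotR a w := by
      have h := LinearMap.pi_apply_eq_sum_univ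
        ((f : ((Fin d → ℝ) × ℝ) →ₗ[ℝ] ℝ) ∘ₗ LinearMap.inl ℝ (Fin d → ℝ) ℝ) w
      simp only [LinearMap.comp_apply, LinearMap.inl_apply, ContinuousLinearMap.coe_coe] at h
      rw [h, dotR, ← Finset.sum_neg_distrib]
      refine Finset.sum_congr rfl fun i _ => ?_
      have h₃ : (fun j => if i = j then (1 : ℝ) else 0) = Pi.single i 1 := by
        ext j; simp [Pi.single_apply, eq_comm]
      rw [h₃, smul_eq_mul, ha]; ring
    have h₂ : f (0, r) = β * r := by
      have h := f.map_smul r ((0 : Fin d → ℝ), (1 : ℝ))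
      rw [Prod.smul_mk, smul_zero, smul_eq_mul, mul_one, smul_eq_mul] at h
      rw [h, hβ, mul_comm]
    have h := f.map_add (w, 0) (0, r)
    rw [Prod.mk_add_mk, add_zero, zero_add] at h
    rw [h, h₁, h₂]
  have hach : ∀ z p, Achieves μ z p → dotZ a z ≤ β * p := fun z p h => by
    have h₁ := hf _ (h.mem_achievableCone hnn hsum)
    rw [hfeq] at h₁
    have : dotR a (fun i => (z i : ℝ)) = dotZ a z := rfl
    linarith
  have hβ0 : 0 ≤ β := by
    have h := hach 0 1 (Achieves.zero.mono zero_le_one)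
    rwa [show dotZ a (0 : Fin d → ℤ) = 0 from (dotZHom a).map_zero, mul_one] at h
  rcases hβ0.eq_or_lt with h0 | hpos
  · have ha0 : ∀ i, a i = 0 := fun i => by
      obtain ⟨p, hp, -⟩ := exists_achieves hnn hsum hA1 (Pi.single i 1)
      obtain ⟨r, hr, -⟩ := exists_achieves hnn hsum hA1 (Pi.single i (-1))
      have h₁ := hach _ _ hp
      have h₂ := hach _ _ hr
      rw [dotZ_single, ← h0] at h₁ h₂
      push_cast at h₁ h₂
      linarith
    rw [hfeq, ← h0] at hf₀
    simp [dotR, ha0] at hf₀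
  · have hD : (fun i => β⁻¹ * a i) ∈ Dset μ := by
      refine mem_Dset_of_forall_achieves hnn hsum fun z p h => ?_
      have h₁ : dotZ (fun i => β⁻¹ * a i) z = β⁻¹ * dotZ a z := by
        simp only [dotZ, Finset.mul_sum, mul_assoc]
      rw [h₁, inv_mul_le_iff₀ hpos]
      exact hach z p h
    have h := hs _ hD
    have h₁ : dotR (fun i => β⁻¹ * a i) v = β⁻¹ * dotR a v := by
      simp only [dotR, Finset.mul_sum, mul_assoc]
    rw [h₁, inv_mul_le_iff₀ hpos] at h
    rw [hfeq] at hf₀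
    linarith

theorem exists_reach_translates (hnn : ∀ z, 0 ≤ μ z) (hsum : HasSum μ 1) (hA1 : A1 μ)
    (Λ : Set (Fin d)) {x y : Fin d → ℤ} (hx : x ∈ posDom Λ) (hy : y ∈ posDom Λ) :
    ∃ p, ∀ u : Fin d → ℤ, (∀ i ∈ Λ, 0 ≤ u i) → Reach μ (posDom Λ) (x + u) (y + u) p := by
  obtain ⟨k, c, h0, hk, hcA, hc⟩ := hA1 Λ x hx y hy
  obtain ⟨p, hp, -⟩ := Reach.exists_of_path hnn hsum c k hc
  have h := hp _ hcA
  rw [h0, hk] at h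
  exact ⟨p, fun u hu => h.shift hnn hsum fun w hw i hi =>
    add_pos_of_pos_of_nonneg (hw i hi) (hu i hi)⟩

/-- Moving between two points of the domain costs at most linearly in their distance. -/
theorem exists_reach_le_dist (hnn : ∀ z, 0 ≤ μ z) (hsum : HasSum μ 1) (hA1 : A1 μ)
    (Λ : Set (Fin d)) : ∃ κ : ℝ, 0 ≤ κ ∧ ∀ x ∈ posDom Λ, ∀ y ∈ posDom Λ,
      Reach μ (posDom Λ) x y (κ * znorm (y - x)) := by
  have h1 : (1 : Fin d → ℤ) ∈ posDom Λ := fun i _ => one_pos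
  have hs : ∀ i, (1 : Fin d → ℤ) + Pi.single i 1 ∈ posDom Λ := fun i j _ => by
    have : (0 : Fin d → ℤ) ≤ Pi.single i 1 := Pi.single_nonneg.2 zero_le_one
    have := this j
    simp only [Pi.add_apply, Pi.one_apply, Pi.zero_apply] at this ⊢
    omega
  choose p hp using fun i => exists_reach_translates hnn hsum hA1 Λ h1 (hs i)
  choose r hr using fun i => exists_reach_translates hnn hsum hA1 Λ (hs i) h1
  set κ : ℝ := ∑ i, (|p i| + |r i|) with hκ
  have hκi : ∀ i, |p i| + |r i| ≤ κ := fun i =>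
    Finset.single_le_sum (f := fun i => |p i| + |r i|) (fun i _ => by positivity)
      (Finset.mem_univ i)
  have hκ0 : 0 ≤ κ := Finset.sum_nonneg fun i _ => by positivity
  have hup : ∀ x ∈ posDom Λ, ∀ i, Reach μ (posDom Λ) x (x + Pi.single i 1) κ := by
    intro x hx i
    have h := hp i (x - 1) fun j hj => Int.le_sub_one_of_lt (hx j hj)
    rw [add_sub_cancel, show 1 + Pi.single i 1 + (x - 1) = x + Pi.single i 1 by abel] at h
    exact h.mono_cost (by linarith [hκi i, le_abs_self (p i), abs_nonneg (r i)])
  have hdown : ∀ x ∈ posDom Λ, ∀ i, Reach μ (posDom Λ) (x + Pi.single i 1) x κ := by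
    intro x hx i
    have h := hr i (x - 1) fun j hj => Int.le_sub_one_of_lt (hx j hj)
    rw [add_sub_cancel, show 1 + Pi.single i 1 + (x - 1) = x + Pi.single i 1 by abel] at h
    exact h.mono_cost (by linarith [hκi i, le_abs_self (r i), abs_nonneg (p i)])
  have key : ∀ n : ℕ, ∀ x ∈ posDom Λ, ∀ y ∈ posDom Λ, ∑ i, (y i - x i).natAbs ≤ n →
      Reach μ (posDom Λ) x y (n * κ) := by
    intro n
    induction n with
    | zero =>
      intro x hx y hy hxy
      have : x = y := by
        ext i
        have h := Finset.sum_eq_zero_iff.1 (Nat.le_zero.1 hxy) i (Finset.mem_univ i)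
        omega
      simpa [this] using Reach.refl hy
    | succ n ih =>
      intro x hx y hy hxy
      by_cases hne : x = y
      · subst hne
        exact (Reach.refl hx).mono_cost (by positivity)
      obtain ⟨i, hi⟩ := Function.ne_iff.1 hne
      obtain ⟨w, hw, hwi, hwj, hreach⟩ : ∃ w ∈ posDom Λ, (y i - w i).natAbs < (y i - x i).natAbs ∧
          (∀ j, j ≠ i → w j = x j) ∧ Reach μ (posDom Λ) x w κ := by
        rcases lt_or_gt_of_ne hi with hlt | hlt
        · refine ⟨x + Pi.single i 1, fun j hj => ?_, ?_, fun j hj => ?_, hup x hx i⟩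
          · have := hx j hj
            by_cases hji : j = i
            · subst hji; simp; omega
            · simpa [hji] using this
          · simp; omega
          · simp [hj]
        · have hmem : x - Pi.single i 1 ∈ posDom Λ := fun j hj => by
            have := hx j hj
            by_cases hji : j = i
            · subst hji
              have := hy j hj
              simp; omega
            · simpa [hji] using this
          refine ⟨x - Pi.single i 1, hmem, ?_, fun j hj => ?_, ?_⟩
          · simp; omega
          · simp [hj]
          · simpa using hdown _ hmem i
      have hlt : ∑ j, (y j - w j).natAbs < ∑ j, (y j - x j).natAbs := by
        refine Finset.sum_lt_sum (fun j _ => ?_) ⟨i, Finset.mem_univ i, hwi⟩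
        by_cases hji : j = i
        · subst hji; exact hwi.le
        · rw [hwj j hji]
      have h := hreach.trans hnn hsum (ih w hw y hy (by omega))
      refine h.mono_cost (le_of_eq ?_)
      push_cast; ring
  refine ⟨κ, hκ0, fun x hx y hy => (key _ x hx y hy le_rfl).mono_cost (le_of_eq ?_)⟩
  simp [znorm, mul_comm, Nat.cast_natAbs]

end LatticeWalk

theorem le_liminf_of_forall_eventually_sub_le {u : ℕ → ℝ} {c : ℝ} (hc : c ≤ 0)
    (h : ∀ η > 0, ∀ᶠ n in atTop, c - η ≤ u n) : c ≤ liminf u atTop := by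
  rw [liminf_eq]
  by_cases hb : BddAbove {a | ∀ᶠ n in atTop, a ≤ u n}
  · refine le_of_forall_pos_le_add fun η hη => ?_
    have := le_csSup hb (h η hη)
    linarith
  · rwa [Real.sSup_of_not_bddAbove hb]

theorem statement8 {d : ℕ} (μ : (Fin d → ℤ) → ℝ)
    (hnn : ∀ z, 0 ≤ μ z) (hsum : HasSum μ 1)
    (hA1 : A1 μ) (hA2 : A2 μ) (hA3 : A3 μ)
    (Λ : Set (Fin d)) (q q' : Fin d → ℝ)
    (hq : ∀ i ∈ Λ, 0 ≤ q i) (hq' : ∀ i ∈ Λ, 0 ≤ q' i)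
    (xs xs' : ℕ → (Fin d → ℤ))
    (hxs : ∀ n, xs n ∈ posDom Λ) (hxs' : ∀ n, xs' n ∈ posDom Λ)
    (ε : ℕ → ℝ) (hε : ∀ n, 0 < ε n) (hε0 : Tendsto ε atTop (𝓝 0))
    (h1 : Tendsto (fun n i => ε n * (xs' n i : ℝ)) atTop (𝓝 q'))
    (h2 : Tendsto (fun n i => ε n * (xs n i : ℝ)) atTop (𝓝 q)) :
    -sSup ((fun a => dotR a (q - q')) '' Dset μ) ≤
      Filter.liminf (fun n => ε n * Real.log (green μ (posDom Λ) (xs' n) (xs n))) atTop := by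
  set v : Fin d → ℝ := q - q'
  set s : ℝ := sSup ((fun a => dotR a v) '' Dset μ)
  have hD : ∀ a ∈ Dset μ, dotR a v ≤ s := fun a ha =>
    le_csSup (bddAbove_dotR_Dset hnn hsum hA1 v) ⟨a, ha, rfl⟩
  have hs0 : 0 ≤ s := by
    have h0 : (0 : Fin d → ℝ) ∈ Dset μ := by
      change phiE μ 0 ≤ 1
      simp only [phiE, dotZ, Pi.zero_apply, zero_mul, Finset.sum_const_zero, Real.exp_zero, mul_one]
      rw [← ENNReal.ofReal_tsum_of_nonneg hnn hsum.summable, hsum.tsum_eq, ENNReal.ofReal_one]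
    simpa [dotR] using hD 0 h0
  refine le_liminf_of_forall_eventually_sub_le (neg_nonpos.2 hs0) fun η hη => ?_
  obtain ⟨κ, hκ0, hκ⟩ := exists_reach_le_dist hnn hsum hA1 Λ
  set δ : ℝ := η / (1 + 5 * κ * d) with hδ
  have hδ0 : 0 < δ := by positivity
  have hδη : δ * (1 + 5 * κ * d) = η := by rw [hδ]; field_simp
  obtain ⟨⟨w, p⟩, ⟨N, hN, z, hz, R, hR⟩, hdist⟩ :=
    Metric.mem_closure_iff.1 (mem_closure_achievableCone hnn hsum hA1 hD) δ hδ0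
  simp only at hz hR
  rw [Prod.dist_eq, max_lt_iff] at hdist
  have hw : ∀ i, |v i - w i| < δ := fun i =>
    (dist_le_pi_dist v w i).trans_lt hdist.1
  have hp : p < s + δ := by
    have := (abs_lt.1 (Real.dist_eq s p ▸ hdist.2)).1
    linarith
  have hN' : (0 : ℝ) < N := by exact_mod_cast hN
  have hinv : Tendsto (fun n => (ε n)⁻¹) atTop atTop :=
    Tendsto.inv_tendsto_nhdsGT_zero
      (tendsto_nhdsWithin_iff.2 ⟨hε0, Eventually.of_forall hε⟩)
  set m : ℕ → ℕ := fun n => ⌊(N : ℝ)⁻¹ * (ε n)⁻¹⌋₊ with hm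
  set c : ℕ → ℕ := fun n => ⌊(2 * δ) * (ε n)⁻¹⌋₊ with hc
  have hmlim : Tendsto (fun n => ε n * m n) atTop (𝓝 (N : ℝ)⁻¹) := by
    refine ((tendsto_nat_floor_mul_div_atTop (inv_nonneg.2 hN'.le)).comp hinv).congr fun n => ?_
    simp only [Function.comp_apply, div_inv_eq_mul, mul_comm, hm]
  have hclim : Tendsto (fun n => ε n * c n) atTop (𝓝 (2 * δ)) := by
    refine ((tendsto_nat_floor_mul_div_atTop (by positivity : 0 ≤ 2 * δ)).comp hinv).congr
      fun n => ?_
    simp only [Function.comp_apply, div_inv_eq_mul, hc]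
    ring
  have hRlim : Tendsto (fun n => ε n * ((|R| : ℤ) : ℝ)) atTop (𝓝 0) := by
    simpa using hε0.mul_const ((|R| : ℤ) : ℝ)
  have hx'lim : ∀ i, Tendsto (fun n => ε n * (xs' n i : ℝ)) atTop (𝓝 (q' i)) :=
    tendsto_pi_nhds.1 h1
  have hxlim : ∀ i, Tendsto (fun n => ε n * (xs n i : ℝ)) atTop (𝓝 (q i)) :=
    tendsto_pi_nhds.1 h2
  have hmz : ∀ i, Tendsto (fun n => ε n * m n * z i) atTop (𝓝 (w i)) := fun i => by
    convert hmlim.mul_const (z i : ℝ) using 2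
    rw [← hz i]; field_simp
  have hend : ∀ i, Tendsto (fun n => ε n * ((xs' n i + c n + m n * z i : ℤ) : ℝ)) atTop
      (𝓝 (q' i + 2 * δ + w i)) := fun i => by
    refine (((hx'lim i).add hclim).add (hmz i)).congr fun n => ?_
    push_cast; ring
  have hstart : ∀ᶠ n in atTop, |R| < c n := by
    filter_upwards [hRlim.eventually_lt hclim (by positivity)] with n hn
    exact_mod_cast lt_of_mul_lt_mul_left hn (hε n).le
  have hfinish : ∀ᶠ n in atTop, ∀ i ∈ Λ, |R| < xs' n i + c n + m n * z i := by
    refine eventually_all.2 fun i => ?_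
    by_cases hi : i ∈ Λ
    · have hpos : 0 < q' i + 2 * δ + w i := by
        have h₁ := (abs_lt.1 (hw i)).2
        have h₂ : v i = q i - q' i := rfl
        have := hq i hi
        linarith
      filter_upwards [hRlim.eventually_lt (hend i) hpos] with n hn _
      exact_mod_cast lt_of_mul_lt_mul_left hn (hε n).le
    · exact Eventually.of_forall fun n h => absurd h hi
  set h : ℕ → Fin d → ℤ := fun n _ => c n with hh
  have hcost : Tendsto (fun n => ε n * (κ * znorm (xs' n + h n - xs' n) + m n * (N * p) +
      κ * znorm (xs n - (xs' n + h n + m n • z)))) atTop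
      (𝓝 (κ * (d * (2 * δ)) + p + κ * ∑ i, |q i - (q' i + 2 * δ + w i)|)) := by
    have hA : Tendsto (fun n => κ * (d * (ε n * c n))) atTop (𝓝 (κ * (d * (2 * δ)))) :=
      (hclim.const_mul _).const_mul _
    have hB : Tendsto (fun n => ε n * m n * (N * p)) atTop (𝓝 p) := by
      convert hmlim.mul_const (N * p) using 2
      field_simp
    have hC := (tendsto_finsetSum Finset.univ fun i _ =>
      ((hxlim i).sub (hend i)).abs).const_mul κ
    refine ((hA.add hB).add hC).congr fun n => ?_
    have h₁ : ε n * znorm (xs n - (xs' n + h n + m n • z)) =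
        ∑ i, |ε n * (xs n i : ℝ) - ε n * ((xs' n i + c n + m n * z i : ℤ) : ℝ)| := by
      rw [znorm, Finset.mul_sum]
      refine Finset.sum_congr rfl fun i _ => ?_
      rw [← mul_sub, abs_mul, abs_of_pos (hε n)]
      simp [hh]
    have h₂ : znorm (xs' n + h n - xs' n) = d * c n := by
      simp [znorm, hh]
    rw [← h₁, h₂]
    ring
  have hlimit : κ * (d * (2 * δ)) + p + κ * ∑ i, |q i - (q' i + 2 * δ + w i)| < s + η := by
    have h₁ : ∑ i, |q i - (q' i + 2 * δ + w i)| ≤ ∑ _i : Fin d, 3 * δ :=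
      Finset.sum_le_sum fun i _ => by
        have h₁ := abs_lt.1 (hw i)
        have h₂ : v i = q i - q' i := rfl
        rw [abs_le]
        constructor <;> linarith [h₁.1, h₁.2]
    rw [Finset.sum_const, Finset.card_univ, Fintype.card_fin, nsmul_eq_mul] at h₁
    have h₂ := mul_le_mul_of_nonneg_left h₁ hκ0
    linarith
  filter_upwards [hstart, hfinish, hcost.eventually_lt_const hlimit] with n hn₁ hn₂ hn₃
  have hmem₁ : xs' n + h n ∈ posDom Λ := fun i hi =>
    add_pos_of_pos_of_nonneg (hxs' n i hi) (Int.natCast_nonneg _)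
  have hmem₂ : xs' n + h n + m n • z ∈ posDom Λ := fun i hi => by
    have := hn₂ i hi
    simpa [hh] using (abs_nonneg R).trans_lt this
  have hreach₂ : Reach μ (posDom Λ) (xs' n + h n) (xs' n + h n + m n • z) (m n * (N * p)) := by
    refine hR.nsmul hnn hsum (m n) hmem₁ fun j hj u hu i hi => ?_
    have h₁ := hn₂ i hi
    have h₂ := hxs' n i hi
    have h₃ := (abs_le.1 ((hu i).trans (le_abs_self R))).1
    have h₄ : |R| < xs' n i + c n + j * z i := by
      have hj' : (j : ℤ) ≤ m n := by exact_mod_cast hj.le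
      rcases le_total 0 (z i) with hzi | hzi
      · have := mul_nonneg (Int.natCast_nonneg j) hzi
        linarith
      · have := mul_le_mul_of_nonpos_right hj' hzi
        linarith
    have h₅ : (j • z) i = j * z i := by simp
    simp only [hh, Pi.add_apply, h₅]
    linarith
  have hreach := ((hκ _ (hxs' n) _ hmem₁).trans hnn hsum hreach₂).trans hnn hsum
    (hκ _ hmem₂ _ (hxs n))
  have hlog := mul_le_mul_of_nonneg_left (hreach.neg_le_log_green hnn hsum) (hε n).le
  linarith
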